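/- Let X be a nonempty set, R a ring of subsets of X, E a Banach space, and μ : R → E a σ-additive set function of bounded variation. Suppose A₁, A₂, … ∈ R and α₁, α₂, … ∈ {−1, 1} satisfy: (I) Σ_{n=1}^∞ |μ|(Aₙ) < ∞, and (II) for every x ∈ X that belongs to only finitely many of the sets Aₙ, one has Σ_{n=1}^∞ αₙ · 1_{Aₙ}(x) = 0. Then the series Σ_{n=1}^∞ αₙ μ(Aₙ) converges in E to 0. -/

import Mathlib

open MeasureTheory Filter
open scoped ENNReal NNReal

/-- A ring of subsets of `X`: a nonempty collection closed under unions and differences. -/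
structure IsRingOfSets {X : Type*} (R : Set (Set X)) : Prop where
  nonempty : R.Nonempty
  union_mem : ∀ ⦃A B : Set X⦄, A ∈ R → B ∈ R → A ∪ B ∈ R
  diff_mem : ∀ ⦃A B : Set X⦄, A ∈ R → B ∈ R → A \ B ∈ R

/-- The variation `|μ|` of a set function `μ : Set X → E`, relative to a collection `R`. -/
noncomputable def variation {X E : Type*} [NormedAddCommGroup E]
    (R : Set (Set X)) (μ : Set X → E) (A : Set X) : ℝ≥0∞ :=
  ⨆ π : {π : Finset (Set X) // ↑π ⊆ R ∧ (π : Set (Set X)).PairwiseDisjoint id ∧ ⋃₀ ↑π = A},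
    ∑ B ∈ π.1, (‖μ B‖₊ : ℝ≥0∞)

/-- `μ` is σ-additive on `R`. -/
def SigmaAdditiveOn {X E : Type*} [AddCommMonoid E] [TopologicalSpace E]
    (R : Set (Set X)) (μ : Set X → E) : Prop :=
  ∀ A : ℕ → Set X, (∀ n, A n ∈ R) → Pairwise (Function.onFun Disjoint A) →
    (⋃ n, A n) ∈ R →
    Tendsto (fun N => ∑ n ∈ Finset.range N, μ (A n)) atTop (nhds (μ (⋃ n, A n)))

theorem IsRingOfSets.isSetRing {X : Type*} {R : Set (Set X)} (hR : IsRingOfSets R) :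
    IsSetRing R where
  empty_mem := by
    obtain ⟨A, hA⟩ := hR.nonempty
    simpa using hR.diff_mem hA hA
  union_mem := hR.union_mem
  sdiff_mem := hR.diff_mem

namespace SigmaAdditiveOn

variable {X E : Type*} [NormedAddCommGroup E] {R : Set (Set X)} {μ : Set X → E}

theorem map_empty (hσ : SigmaAdditiveOn R μ) (h : ∅ ∈ R) : μ ∅ = 0 := by
  have h1 := hσ (fun _ => ∅) (fun _ => h) (fun _ _ _ => disjoint_bot_left) (by simpa using h)
  have h2 := ((tendsto_add_atTop_iff_nat 1).2 h1).sub h1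
  simpa [Finset.sum_range_succ, -Finset.sum_const] using h2

theorem map_union (hR : IsRingOfSets R) (hσ : SigmaAdditiveOn R μ) {s t : Set X}
    (hs : s ∈ R) (ht : t ∈ R) (hst : Disjoint s t) : μ (s ∪ t) = μ s + μ t := by
  have he := hR.isSetRing.empty_mem
  let f : ℕ → Set X := fun n => Nat.casesOn n s fun n => Nat.casesOn n t fun _ => ∅
  have hU : ⋃ n, f n = s ∪ t := by
    rw [← Set.union_iUnion_nat_succ, ← Set.union_iUnion_nat_succ]
    simp [f]
  have h := hσ f (by rintro (_ | _ | n) <;> assumption)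
    (by rintro (_ | _ | i) (_ | _ | j) hij <;> simp_all [f, Function.onFun, hst.symm])
    (hU ▸ hR.union_mem hs ht)
  rw [hU, ← tendsto_add_atTop_iff_nat 2] at h
  refine tendsto_nhds_unique h (tendsto_const_nhds.congr fun n => ?_)
  simp [Finset.sum_range_succ', f, hσ.map_empty he, add_comm]

end SigmaAdditiveOn

section Variation

variable {X E : Type*} [NormedAddCommGroup E] {R : Set (Set X)} {μ : Set X → E}

theorem sum_enorm_le_variation (h0 : μ ∅ = 0) {ι : Type*} {s : Finset ι} {f : ι → Set X}
    (hf : ∀ i ∈ s, f i ∈ R) (hd : (s : Set ι).PairwiseDisjoint f) :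
    ∑ i ∈ s, ‖μ (f i)‖ₑ ≤ variation R μ (⋃ i ∈ s, f i) := by
  classical
  have hsum : ∑ B ∈ s.image f, ‖μ B‖ₑ = ∑ i ∈ s, ‖μ (f i)‖ₑ := by
    refine Finset.sum_image_of_pairwise_eq_zero fun i hi j hj hij hfij => ?_
    have := hd hi hj hij
    rw [Function.onFun, ← hfij, disjoint_self, Set.bot_eq_empty] at this
    simp [this, h0]
  rw [← hsum]
  refine le_iSup_of_le ⟨s.image f, ?_, ?_, ?_⟩ le_rfl
  · simpa [Set.subset_def] using hf
  · simpa using! hd.image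
  · simp

theorem enorm_le_variation {A : Set X} (hA : A ∈ R) : ‖μ A‖ₑ ≤ variation R μ A :=
  le_iSup_of_le ⟨{A}, by simpa using hA, by simp, by simp⟩ (by simp [enorm])

theorem variation_empty (h0 : μ ∅ = 0) : variation R μ ∅ = 0 := by
  refine le_antisymm (iSup_le ?_) zero_le
  rintro ⟨π, hR, hd, hU⟩
  refine (Finset.sum_eq_zero fun B hB => ?_).le
  have : B = ∅ := Set.sUnion_eq_empty.1 hU B hB
  simp [this, h0]

theorem variation_iUnion_le (hR : IsRingOfSets R) (hσ : SigmaAdditiveOn R μ) {f : ℕ → Set X}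
    (hf : ∀ n, f n ∈ R) (hd : Pairwise (Function.onFun Disjoint f)) :
    variation R μ (⋃ n, f n) ≤ ∑' n, variation R μ (f n) := by
  have h0 := hσ.map_empty hR.isSetRing.empty_mem
  refine iSup_le ?_
  rintro ⟨π, hπ, hπd, hU⟩
  have hB : ∀ B ∈ π, ‖μ B‖ₑ ≤ ∑' n, ‖μ (B ∩ f n)‖ₑ := fun B hB => by
    have hBU : ⋃ n, B ∩ f n = B := by
      rw [← Set.inter_iUnion, Set.inter_eq_left, ← hU]
      exact Set.subset_sUnion_of_mem hB
    have h := hσ (fun n => B ∩ f n) (fun n => hR.isSetRing.inter_mem (hπ hB) (hf n))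
      (fun i j hij => (hd hij).mono Set.inter_subset_right Set.inter_subset_right)
      (by rw [hBU]; exact hπ hB)
    rw [hBU] at h
    exact le_of_tendsto h.enorm
      (Eventually.of_forall fun N => (enorm_sum_le _ _).trans (ENNReal.sum_le_tsum _))
  calc ∑ B ∈ π, ‖μ B‖ₑ ≤ ∑ B ∈ π, ∑' n, ‖μ (B ∩ f n)‖ₑ := Finset.sum_le_sum hB
    _ = ∑' n, ∑ B ∈ π, ‖μ (B ∩ f n)‖ₑ := (Summable.tsum_finsetSum fun _ _ => ENNReal.summable).symm
    _ ≤ ∑' n, variation R μ (f n) := by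
      refine ENNReal.tsum_le_tsum fun n => ?_
      have hUn : ⋃ B ∈ π, B ∩ f n = f n := by
        rw [← Set.iUnion₂_inter, Set.inter_eq_right]
        have : f n ⊆ ⋃₀ ↑π := hU ▸ Set.subset_iUnion f n
        simpa [Set.sUnion_eq_biUnion] using this
      have := sum_enorm_le_variation h0 (s := π) (f := fun B => B ∩ f n)
        (fun B hB => hR.isSetRing.inter_mem (hπ hB) (hf n))
        (fun B hB C hC hBC => (hπd hB hC hBC).mono Set.inter_subset_left Set.inter_subset_left)
      rwa [hUn] at this

theorem variation_union_le (hR : IsRingOfSets R) (hσ : SigmaAdditiveOn R μ) {s t : Set X}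
    (hs : s ∈ R) (ht : t ∈ R) (hst : Disjoint s t) :
    variation R μ (s ∪ t) ≤ variation R μ s + variation R μ t := by
  have he := hR.isSetRing.empty_mem
  let f : ℕ → Set X := fun n => Nat.casesOn n s fun n => Nat.casesOn n t fun _ => ∅
  have hU : ⋃ n, f n = s ∪ t := by
    rw [← Set.union_iUnion_nat_succ, ← Set.union_iUnion_nat_succ]
    simp [f]
  have h := variation_iUnion_le hR hσ (f := f) (by rintro (_ | _ | n) <;> assumption)
    (by rintro (_ | _ | i) (_ | _ | j) hij <;> simp_all [f, Function.onFun, hst.symm])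
  rw [hU, tsum_eq_zero_add' ENNReal.summable, tsum_eq_zero_add' ENNReal.summable] at h
  simpa [f, variation_empty (R := R) (hσ.map_empty he)] using h

theorem le_variation_union (h0 : μ ∅ = 0) {s t : Set X} (hs : s ∈ R) (ht : t ∈ R)
    (hst : Disjoint s t) :
    variation R μ s + variation R μ t ≤ variation R μ (s ∪ t) := by
  have hne : ∀ {u : Set X}, u ∈ R → Nonempty {π : Finset (Set X) // ↑π ⊆ R ∧
      (π : Set (Set X)).PairwiseDisjoint id ∧ ⋃₀ ↑π = u} := fun {u} hu =>
    ⟨⟨{u}, by simpa using hu, by simp, by simp⟩⟩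
  have := hne hs
  have := hne ht
  refine ENNReal.iSup_add_iSup_le ?_
  rintro ⟨P, hP, hPd, rfl⟩ ⟨Q, hQ, hQd, rfl⟩
  have h := sum_enorm_le_variation (R := R) h0 (s := P.disjSum Q)
    (f := Sum.elim (fun B => B) (fun B => B)) ?_ ?_
  · have hU : ⋃ i ∈ P.disjSum Q, Sum.elim (fun B => B) (fun B => B) i = ⋃₀ ↑P ∪ ⋃₀ ↑Q := by
      ext x
      simp
    rwa [Finset.sum_disjSum, hU] at h
  · rintro (B | B) hB
    · exact hP (by simpa using hB)
    · exact hQ (by simpa using hB)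
  · rintro (B | B) hB (C | C) hC hBC
    · exact hPd (by simpa using hB) (by simpa using hC) (by simpa using hBC)
    · exact hst.mono (Set.subset_sUnion_of_mem (by simpa using hB))
        (Set.subset_sUnion_of_mem (by simpa using hC))
    · exact hst.symm.mono (Set.subset_sUnion_of_mem (by simpa using hB))
        (Set.subset_sUnion_of_mem (by simpa using hC))
    · exact hQd (by simpa using hB) (by simpa using hC) (by simpa using hBC)

/-- The variation of a σ-additive set function on a ring extends to a measure on the generated
σ-algebra. -/
theorem exists_measure_eq_variation (hR : IsRingOfSets R) (hσ : SigmaAdditiveOn R μ) :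
    ∃ m : @Measure X (MeasurableSpace.generateFrom R), ∀ A ∈ R, m A = variation R μ A := by
  have h0 := hσ.map_empty hR.isSetRing.empty_mem
  let c : AddContent ℝ≥0∞ R := hR.isSetRing.addContent_of_union (variation R μ)
    (variation_empty h0)
    fun hs ht hst => (variation_union_le hR hσ hs ht hst).antisymm (le_variation_union h0 hs ht hst)
  have hc : c.IsSigmaSubadditive :=
    isSigmaSubadditive_of_addContent_iUnion_eq_tsum hR.isSetRing fun f hf hU hd =>
      addContent_iUnion_eq_tsum_of_disjoint_of_addContent_iUnion_le hR.isSetRing.isSetSemiring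
        (fun g hg _ hgd => variation_iUnion_le hR hσ hg hgd) f hf hU hd
  let _ : MeasurableSpace X := MeasurableSpace.generateFrom R
  exact ⟨c.measure hR.isSetRing.isSetSemiring le_rfl hc, fun A hA =>
    c.measure_eq hR.isSetRing.isSetSemiring rfl hc hA⟩

end Variation

/-- An additive set function dominated in norm by a measure `m` integrates simple functions over
a ring to vectors of norm at most the `L¹(m)` norm. -/
theorem enorm_smul_add_sum_le_setLIntegral {X E : Type*} [NormedAddCommGroup E] [NormedSpace ℝ E]
    {_ : MeasurableSpace X} {R : Set (Set X)} (hR : IsSetRing R)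
    (hmeas : ∀ A ∈ R, MeasurableSet A) {μ : Set X → E} {m : Measure X}
    (hadd : ∀ s ∈ R, ∀ t ∈ R, Disjoint s t → μ (s ∪ t) = μ s + μ t)
    (hle : ∀ s ∈ R, ‖μ s‖ₑ ≤ m s) {A : ℕ → Set X} (hA : ∀ n, A n ∈ R) (α : ℕ → ℝ) (N : ℕ)
    {B : Set X} (hB : B ∈ R) (c : ℝ) :
    ‖c • μ B + ∑ n ∈ Finset.range N, α n • μ (B ∩ A n)‖ₑ ≤
      ∫⁻ x in B, ‖c + ∑ n ∈ Finset.range N, (A n).indicator (fun _ => α n) x‖ₑ ∂m := by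
  induction N generalizing B c with
  | zero =>
    simp only [Finset.range_zero, Finset.sum_empty, add_zero, enorm_smul, setLIntegral_const]
    gcongr
    exact hle B hB
  | succ N ih =>
    have hsplit : ∀ s ∈ R, μ s = μ (s ∩ A N) + μ (s \ A N) := fun s hs => by
      rw [← hadd _ (hR.inter_mem hs (hA N)) _ (hR.sdiff_mem hs (hA N))
        Set.disjoint_sdiff_inter.symm, Set.inter_union_sdiff]
    have hin := hR.inter_mem hB (hA N)
    have hdi := hR.sdiff_mem hB (hA N)
    have key : c • μ B + ∑ n ∈ Finset.range (N + 1), α n • μ (B ∩ A n) =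
        ((c + α N) • μ (B ∩ A N) + ∑ n ∈ Finset.range N, α n • μ (B ∩ A N ∩ A n)) +
        (c • μ (B \ A N) + ∑ n ∈ Finset.range N, α n • μ (B \ A N ∩ A n)) := by
      have : ∀ n, μ (B ∩ A n) = μ (B ∩ A N ∩ A n) + μ (B \ A N ∩ A n) := fun n => by
        rw [hsplit _ (hR.inter_mem hB (hA n)), Set.inter_right_comm, Set.sdiff_inter_right_comm]
      rw [Finset.sum_range_succ, Finset.sum_congr rfl fun n _ => by rw [this n, smul_add],
        Finset.sum_add_distrib, hsplit B hB]
      module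
    rw [key, ← lintegral_inter_add_sdiff _ B (hmeas _ (hA N))]
    refine (enorm_add_le _ _).trans (add_le_add ((ih hin _).trans_eq ?_) ((ih hdi _).trans_eq ?_))
    · refine setLIntegral_congr_fun (hmeas _ hin) fun x hx => ?_
      simp only [Finset.sum_range_succ, Set.indicator_of_mem hx.2]
      ring_nf
    · refine setLIntegral_congr_fun (hmeas _ hdi) fun x hx => ?_
      simp only [Finset.sum_range_succ, Set.indicator_of_notMem hx.2, add_zero]

/-- Let `μ : R → E` be a σ-additive set function of bounded variation on a
ring of subsets `R` of a nonempty set `X`, with values in a Banach space `E`.  If `Aₙ ∈ R`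
and `αₙ ∈ {−1, 1}` satisfy `∑ₙ |μ|(Aₙ) < ∞` and, for every `x` belonging to only finitely
many `Aₙ`, `∑ₙ αₙ 1_{Aₙ}(x) = 0`, then `∑ₙ αₙ μ(Aₙ)` converges to `0` in `E`. -/
theorem stmt3 {X E : Type*} [Nonempty X]
    [NormedAddCommGroup E] [NormedSpace ℝ E] [CompleteSpace E]
    (R : Set (Set X)) (hR : IsRingOfSets R)
    (μ : Set X → E)
    (hσ : SigmaAdditiveOn R μ)
    (hbv : (⨆ A ∈ R, variation R μ A) < ⊤)
    (A : ℕ → Set X) (hA : ∀ n, A n ∈ R)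
    (α : ℕ → ℝ) (hα : ∀ n, α n = 1 ∨ α n = -1)
    (hI : ∑' n, variation R μ (A n) < ⊤)
    (hII : ∀ x : X, ∀ hx : {n : ℕ | x ∈ A n}.Finite, ∑ n ∈ hx.toFinset, α n = 0) :
    Tendsto (fun N => ∑ n ∈ Finset.range N, α n • μ (A n)) atTop (nhds (0 : E)) := by
  have hring := hR.isSetRing
  obtain ⟨m, hm⟩ := exists_measure_eq_variation hR hσ
  let _ : MeasurableSpace X := MeasurableSpace.generateFrom R
  have hmeas : ∀ B ∈ R, MeasurableSet B := fun B hB => MeasurableSpace.measurableSet_generateFrom hB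
  have hsum : ∑' n, m (A n) ≠ ∞ := by simpa only [hm _ (hA _)] using hI.ne
  let f : ℕ → X → ℝ := fun N x => ∑ n ∈ Finset.range N, (A n).indicator (fun _ => α n) x
  have hαe : ∀ n, ‖α n‖ₑ = 1 := fun n => by rcases hα n with h | h <;> simp [h]
  have hfm : ∀ n, Measurable ((A n).indicator fun _ => α n) := fun n =>
    measurable_const.indicator (hmeas _ (hA n))
  have hbound : ∀ N, ‖∑ n ∈ Finset.range N, α n • μ (A n)‖ₑ ≤ ∫⁻ x, ‖f N x‖ₑ ∂m := fun N => by
    have hU : (⋃ n ∈ Finset.range N, A n) ∈ R := hring.biUnion_mem _ fun n _ => hA n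
    have h := enorm_smul_add_sum_le_setLIntegral hring hmeas
      (fun s hs t ht => hσ.map_union hR hs ht)
      (fun s hs => (enorm_le_variation hs).trans_eq (hm s hs).symm) hA α N hU 0
    rw [zero_smul, zero_add, Finset.sum_congr rfl fun n hn => by
      rw [Set.inter_eq_right.2 (Set.subset_iUnion₂_of_subset n hn le_rfl)]] at h
    simp only [zero_add] at h
    exact h.trans (setLIntegral_le_lintegral _ _)
  have hlim : Tendsto (fun N => ∫⁻ x, ‖f N x‖ₑ ∂m) atTop (nhds (∫⁻ _, 0 ∂m)) := by
    refine tendsto_lintegral_of_dominated_convergence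
      (fun x => ∑' n, ‖(A n).indicator (fun _ => α n) x‖ₑ)
      (fun N => (Finset.measurable_fun_sum _ fun n _ => hfm n).enorm)
      (fun N => Eventually.of_forall fun x =>
        (enorm_sum_le _ _).trans (ENNReal.sum_le_tsum _)) ?_ ?_
    · rw [lintegral_tsum fun n => (hfm n).enorm.aemeasurable]
      simpa [enorm_indicator_eq_indicator_enorm, hαe, lintegral_indicator, hmeas _ (hA _)] using hsum
    · filter_upwards [ae_finite_setOfPred_mem hsum] with x hx
      refine tendsto_const_nhds.congr' ?_
      obtain ⟨K, hK⟩ := hx.bddAbove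
      filter_upwards [eventually_gt_atTop K] with N hN
      have : f N x = 0 := by
        classical
        have hfilter : hx.toFinset = {n ∈ Finset.range N | x ∈ A n} := by
          ext n
          simpa using fun hn => (hK hn).trans_lt hN
        rw [← hII x hx, hfilter, Finset.sum_filter]
        exact Finset.sum_congr rfl fun n _ => by simp [Set.indicator_apply]
      simp [this]
  rw [lintegral_zero] at hlim
  rw [tendsto_zero_iff_enorm_tendsto_zero]
  exact tendsto_of_tendsto_of_tendsto_of_le_of_le tendsto_const_nhds hlim (fun _ => zero_le) hbound
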